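/- Let $0 < \varepsilon < 1$ and let $u : \mathbb{R}^3 \to \mathbb{C}$ be continuously differentiable and compactly supported. Set $\Gamma_\varepsilon u(x) = \varepsilon^{3/2} u(\varepsilon x)$ and $u_{\varepsilon,\theta}(y) = (U\Gamma_\varepsilon u)(\theta, y)$ where $Ug(\theta,y) = (2\pi)^{-3/2}\sum_{m\in\mathbb{Z}^3} g(y+m) e^{-\mathrm{i}\,\theta\cdot(y+m)}$. Then the following Floquet decomposition of the energy form holds: $\int_{\mathbb{R}^3} \big( A_\varepsilon(x/\varepsilon)\nabla u(x) \cdot \overline{\nabla u(x)} + |u(x)|^2 \big)\,\mathrm{d}x = \int_{[-\pi,\pi)^3} \big( \varepsilon^{-2} a_\theta[u_{\varepsilon,\theta}] + b_\theta[u_{\varepsilon,\theta}] \big)\,\mathrm{d}\theta$, where $a_\theta[v] = \int_{\square\setminus F} |\nabla v + \mathrm{i}\theta v|^2\,\mathrm{d}y + \int_{\square\cap F} a(y_3)|\partial_3 v + \mathrm{i}\theta_3 v|^2\,\mathrm{d}y$ and $b_\theta[v] = \int_{\square\cap F} |\nabla' v + \mathrm{i}\theta' v|^2\,\mathrm{d}y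 + \int_{\square} |v|^2\,\mathrm{d}y$ with $\nabla' = (\partial_1,\partial_2)$ and $\theta' = (\theta_1,\theta_2)$. -/

import Mathlib

open MeasureTheory
open scoped Classical

/-- The Gelfand transform of `f : ℝ³ → ℂ`:
`Uf(θ,y) = (2π)^{-3/2} ∑_{m ∈ ℤ³} f(y+m) e^{-i θ·(y+m)}`. -/
noncomputable def gelfand (f : (Fin 3 → ℝ) → ℂ) (θ y : Fin 3 → ℝ) : ℂ :=
  (((2 * Real.pi) ^ (-(3 : ℝ) / 2) : ℝ) : ℂ) *
    ∑' m : Fin 3 → ℤ,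
      f (y + fun i => (m i : ℝ)) *
        Complex.exp (-Complex.I * ((∑ i, θ i * (y i + (m i : ℝ)) : ℝ) : ℂ))

/-- The partial derivative `∂_j f` of a function `f : ℝ³ → ℂ`. -/
noncomputable def pd3 (f : (Fin 3 → ℝ) → ℂ) (j : Fin 3) (x : Fin 3 → ℝ) : ℂ :=
  fderiv ℝ f x (Pi.single j 1)

/-- The dual cell `□* = [-π,π)³`. -/
noncomputable def dualCell : Set (Fin 3 → ℝ) :=
  Set.univ.pi fun _ => Set.Ico (-Real.pi) Real.pi

/-- The periodic reference cell `□ = [-1/2,1/2)³`. -/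
noncomputable def cell : Set (Fin 3 → ℝ) :=
  Set.univ.pi fun _ => Set.Ico (-(1 : ℝ) / 2) (1 / 2)

/-- The periodically extended fibre set `⋃_{m' ∈ ℤ²} (B + m') × ℝ`, where `B` is the open
disk of radius `r` centred at the origin. -/
def fiberSet (r : ℝ) : Set (Fin 3 → ℝ) :=
  {y | ∃ m : Fin 2 → ℤ, (y 0 - (m 0 : ℝ)) ^ 2 + (y 1 - (m 1 : ℝ)) ^ 2 < r ^ 2}

/-- The quadratic form `a_θ[v] = ∫_{□∖F} |∇v + iθv|² dy + ∫_{□∩F} a(y₃)|∂₃v + iθ₃v|² dy`. -/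
noncomputable def aForm (a : ℝ → ℝ) (r : ℝ) (θ : Fin 3 → ℝ) (v : (Fin 3 → ℝ) → ℂ) : ℝ :=
  ∫ y in cell,
    if y ∈ fiberSet r then
      a (y 2) * ‖pd3 v 2 y + Complex.I * (θ 2 : ℂ) * v y‖ ^ 2
    else
      ∑ j, ‖pd3 v j y + Complex.I * (θ j : ℂ) * v y‖ ^ 2

/-- The quadratic form `b_θ[v] = ∫_{□∩F} |∇'v + iθ'v|² dy + ∫_□ |v|² dy`. -/
noncomputable def bForm (r : ℝ) (θ : Fin 3 → ℝ) (v : (Fin 3 → ℝ) → ℂ) : ℝ :=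
  (∫ y in cell,
    if y ∈ fiberSet r then
      ‖pd3 v 0 y + Complex.I * (θ 0 : ℂ) * v y‖ ^ 2 +
        ‖pd3 v 1 y + Complex.I * (θ 1 : ℂ) * v y‖ ^ 2
    else 0) +
  ∫ y in cell, ‖v y‖ ^ 2

lemma exists_finset_forall_add_intCast_eq_zero {E : Type*} [Zero E] {h : (Fin 3 → ℝ) → E}
    (hs : HasCompactSupport h) (R : ℝ) :
    ∃ S : Finset (Fin 3 → ℤ), ∀ y : Fin 3 → ℝ, ‖y‖ ≤ R → ∀ m ∉ S,
      h (y + fun i => (m i : ℝ)) = 0 := by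
  obtain ⟨R', hR'⟩ := hs.isCompact.isBounded.subset_closedBall 0
  refine ⟨Finset.Icc (fun _ => -⌈R + R'⌉) (fun _ => ⌈R + R'⌉), fun y hy m hm => ?_⟩
  by_contra hne
  apply hm
  have h1 : ‖y + fun i => (m i : ℝ)‖ ≤ R' := by
    simpa using hR' (subset_tsupport h hne)
  have key : ∀ i, |(m i : ℝ)| ≤ R + R' := fun i => by
    have h2 := norm_le_pi_norm (y + fun i => (m i : ℝ)) i
    have h3 := norm_le_pi_norm y i
    simp only [Pi.add_apply, Real.norm_eq_abs] at h2 h3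
    have h4 := abs_sub (y i + (m i : ℝ)) (y i)
    rw [add_sub_cancel_left] at h4
    linarith
  have key2 : ∀ i, |m i| ≤ ⌈R + R'⌉ := fun i => by
    have : ((|m i| : ℤ) : ℝ) ≤ (⌈R + R'⌉ : ℝ) := by
      push_cast
      exact (key i).trans (Int.le_ceil _)
    exact_mod_cast this
  rw [Finset.mem_Icc]
  exact ⟨fun i => (abs_le.1 (key2 i)).1, fun i => (abs_le.1 (key2 i)).2⟩

/-- The Gelfand transform with the lattice sum restricted to a finite set. -/
noncomputable def gelfandFinset (S : Finset (Fin 3 → ℤ)) (f : (Fin 3 → ℝ) → ℂ)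
    (θ y : Fin 3 → ℝ) : ℂ :=
  (((2 * Real.pi) ^ (-(3 : ℝ) / 2) : ℝ) : ℂ) *
    ∑ m ∈ S,
      f (y + fun i => (m i : ℝ)) *
        Complex.exp (-Complex.I * ((∑ i, θ i * (y i + (m i : ℝ)) : ℝ) : ℂ))

lemma gelfand_eq_gelfandFinset {S : Finset (Fin 3 → ℤ)} {f : (Fin 3 → ℝ) → ℂ}
    {y : Fin 3 → ℝ} (hS : ∀ m ∉ S, f (y + fun i => (m i : ℝ)) = 0) (θ : Fin 3 → ℝ) :
    gelfand f θ y = gelfandFinset S f θ y := by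
  unfold gelfand gelfandFinset
  rw [tsum_eq_sum fun m hm => by rw [hS m hm, zero_mul]]

lemma continuous_gelfandFinset (S : Finset (Fin 3 → ℤ)) {f : (Fin 3 → ℝ) → ℂ}
    (hf : Continuous f) :
    Continuous fun p : (Fin 3 → ℝ) × (Fin 3 → ℝ) => gelfandFinset S f p.1 p.2 := by
  unfold gelfandFinset
  fun_prop

lemma pd3_gelfandFinset_add (S : Finset (Fin 3 → ℤ)) {f : (Fin 3 → ℝ) → ℂ}
    (hf : Differentiable ℝ f) (θ y : Fin 3 → ℝ) (j : Fin 3) :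
    pd3 (gelfandFinset S f θ) j y + Complex.I * (θ j : ℂ) * gelfandFinset S f θ y =
      gelfandFinset S (pd3 f j) θ y := by
  have hterm : ∀ m : Fin 3 → ℤ, HasFDerivAt (fun y : Fin 3 → ℝ =>
      f (y + fun i => (m i : ℝ)) *
        Complex.exp (-Complex.I * ((∑ i, θ i * (y i + (m i : ℝ)) : ℝ) : ℂ)))
      (f (y + fun i => (m i : ℝ)) •
        (Complex.exp (-Complex.I * ((∑ i, θ i * (y i + (m i : ℝ)) : ℝ) : ℂ)) •
          (-Complex.I) • (Complex.ofRealCLM.comp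
            (∑ i, θ i • (ContinuousLinearMap.proj i : (Fin 3 → ℝ) →L[ℝ] ℝ)))) +
        Complex.exp (-Complex.I * ((∑ i, θ i * (y i + (m i : ℝ)) : ℝ) : ℂ)) •
          fderiv ℝ f (y + fun i => (m i : ℝ))) y := fun m => by
    have h1 : HasFDerivAt (fun y : Fin 3 → ℝ => f (y + fun i => (m i : ℝ)))
        (fderiv ℝ f (y + fun i => (m i : ℝ))) y := by
      rw [hasFDerivAt_comp_add_right]
      exact (hf _).hasFDerivAt
    have h2 : HasFDerivAt (fun y : Fin 3 → ℝ => ∑ i, θ i * (y i + (m i : ℝ)))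
        (∑ i, θ i • (ContinuousLinearMap.proj i : (Fin 3 → ℝ) →L[ℝ] ℝ)) y := by
      refine HasFDerivAt.fun_sum fun i _ => ?_
      exact ((hasFDerivAt_apply i y).add_const _).const_mul _
    exact h1.mul (((Complex.ofRealCLM.hasFDerivAt.comp y h2).const_mul (-Complex.I)).cexp)
  have hsum := (HasFDerivAt.fun_sum (u := S) fun m _ => hterm m).const_mul
    (((2 * Real.pi) ^ (-(3 : ℝ) / 2) : ℝ) : ℂ)
  have hsum' : HasFDerivAt (gelfandFinset S f θ) _ y := hsum
  unfold pd3
  rw [hsum'.fderiv]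
  unfold gelfandFinset
  simp only [_root_.smul_apply, _root_.sum_apply,
    _root_.add_apply, ContinuousLinearMap.comp_apply, ContinuousLinearMap.proj_apply,
    smul_eq_mul, Complex.ofRealCLM_apply, Pi.single_apply, mul_ite, mul_one, mul_zero,
    Finset.sum_ite_eq', Finset.mem_univ, if_true]
  rw [mul_left_comm, ← mul_add, Finset.mul_sum, ← Finset.sum_add_distrib]
  congr 1
  refine Finset.sum_congr rfl fun m _ => ?_
  ring

lemma integral_Ico_exp_neg_I_int_mul (k : ℤ) :
    ∫ t in Set.Ico (-Real.pi) Real.pi, Complex.exp (-Complex.I * (t * (k : ℂ))) =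
      if k = 0 then 2 * (Real.pi : ℂ) else 0 := by
  rw [integral_Ico_eq_integral_Ioc,
    ← intervalIntegral.integral_of_le (by linarith [Real.pi_pos])]
  split_ifs with hk
  · simp [hk]
    ring
  · have hc : -Complex.I * (k : ℂ) ≠ 0 := by simp [hk]
    have := integral_exp_mul_complex (a := -Real.pi) (b := Real.pi) hc
    simp only [mul_comm (_ : ℂ) (k : ℂ), ← mul_assoc] at this ⊢
    simp only [mul_comm (k : ℂ) (-Complex.I)] at this ⊢
    rw [this, div_eq_zero_iff, sub_eq_zero]
    left
    rw [Complex.exp_eq_exp_iff_exists_int]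
    refine ⟨-k, ?_⟩
    push_cast
    ring

lemma integral_dualCell_exp_mul_conj (y : Fin 3 → ℝ) (m n : Fin 3 → ℤ) :
    ∫ θ in dualCell,
        Complex.exp (-Complex.I * ((∑ i, θ i * (y i + (m i : ℝ)) : ℝ) : ℂ)) *
        (starRingEnd ℂ)
          (Complex.exp (-Complex.I * ((∑ i, θ i * (y i + (n i : ℝ)) : ℝ) : ℂ))) =
      if m = n then (2 * (Real.pi : ℂ)) ^ 3 else 0 := by
  have h1 : ∀ θ : Fin 3 → ℝ,
      Complex.exp (-Complex.I * ((∑ i, θ i * (y i + (m i : ℝ)) : ℝ) : ℂ)) *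
        (starRingEnd ℂ)
          (Complex.exp (-Complex.I * ((∑ i, θ i * (y i + (n i : ℝ)) : ℝ) : ℂ))) =
      ∏ i, Complex.exp (-Complex.I * (θ i * ((m i - n i : ℤ) : ℂ))) := fun θ => by
    rw [← Complex.exp_conj, ← Complex.exp_add, ← Complex.exp_sum]
    congr 1
    simp only [map_mul, map_neg, Complex.conj_I, Complex.conj_ofReal, Fin.sum_univ_three]
    push_cast
    ring
  simp only [h1]
  rw [dualCell, volume_pi, Measure.restrict_pi_pi,
    integral_fintype_prod_eq_prod (f := fun i (t : ℝ) =>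
      Complex.exp (-Complex.I * (t * ((m i - n i : ℤ) : ℂ))))]
  simp only [integral_Ico_exp_neg_I_int_mul, sub_eq_zero]
  split_ifs with h
  · simp [h]
  · obtain ⟨i, hi⟩ := Function.ne_iff.1 h
    exact Finset.prod_eq_zero (Finset.mem_univ i) (if_neg hi)

lemma dualCell_subset_Icc : dualCell ⊆ Set.Icc (fun _ => -Real.pi) (fun _ => Real.pi) :=
  fun _ hx => ⟨fun i => (hx i trivial).1, fun i => (hx i trivial).2.le⟩

lemma cell_subset_Icc : cell ⊆ Set.Icc (fun _ => -(1 : ℝ) / 2) (fun _ => 1 / 2) :=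
  fun _ hx => ⟨fun i => (hx i trivial).1, fun i => (hx i trivial).2.le⟩

lemma norm_le_of_mem_cell {y : Fin 3 → ℝ} (hy : y ∈ cell) : ‖y‖ ≤ 1 / 2 := by
  refine (pi_norm_le_iff_of_nonneg (by norm_num)).2 fun i => abs_le.2 ⟨?_, ?_⟩
  · linarith [(hy i trivial).1]
  · exact (hy i trivial).2.le

lemma measurableSet_cell : MeasurableSet cell :=
  MeasurableSet.univ_pi fun _ => measurableSet_Ico

lemma measurableSet_dualCell : MeasurableSet dualCell :=
  MeasurableSet.univ_pi fun _ => measurableSet_Ico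

lemma integral_dualCell_norm_sq_gelfandFinset (S : Finset (Fin 3 → ℤ))
    (f : (Fin 3 → ℝ) → ℂ) (y : Fin 3 → ℝ) :
    ∫ θ in dualCell, ‖gelfandFinset S f θ y‖ ^ 2 =
      ∑ m ∈ S, ‖f (y + fun i => (m i : ℝ))‖ ^ 2 := by
  apply Complex.ofReal_injective
  rw [← integral_complex_ofReal]
  have h1 : ∀ θ : Fin 3 → ℝ, ((‖gelfandFinset S f θ y‖ ^ 2 : ℝ) : ℂ) =
      ∑ m ∈ S, ∑ n ∈ S, ((2 * (Real.pi : ℂ)) ^ 3)⁻¹ *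
        (f (y + fun i => (m i : ℝ)) * (starRingEnd ℂ) (f (y + fun i => (n i : ℝ)))) *
        (Complex.exp (-Complex.I * ((∑ i, θ i * (y i + (m i : ℝ)) : ℝ) : ℂ)) *
        (starRingEnd ℂ)
          (Complex.exp (-Complex.I * ((∑ i, θ i * (y i + (n i : ℝ)) : ℝ) : ℂ)))) := fun θ => by
    have hc : (((2 * Real.pi) ^ (-(3 : ℝ) / 2) : ℝ) : ℂ) *
        (((2 * Real.pi) ^ (-(3 : ℝ) / 2) : ℝ) : ℂ) = ((2 * (Real.pi : ℂ)) ^ 3)⁻¹ := by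
      rw [← Complex.ofReal_mul, ← Real.rpow_add (by positivity)]
      norm_num
    rw [Complex.ofReal_pow, ← Complex.mul_conj', gelfandFinset, map_mul, map_sum,
      Complex.conj_ofReal, mul_mul_mul_comm, hc, Finset.sum_mul_sum, Finset.mul_sum]
    refine Finset.sum_congr rfl fun m _ => ?_
    rw [Finset.mul_sum]
    refine Finset.sum_congr rfl fun n _ => ?_
    rw [map_mul]
    ring
  have hint : ∀ m n : Fin 3 → ℤ, IntegrableOn (fun θ : Fin 3 → ℝ =>
      ((2 * (Real.pi : ℂ)) ^ 3)⁻¹ *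
        (f (y + fun i => (m i : ℝ)) * (starRingEnd ℂ) (f (y + fun i => (n i : ℝ)))) *
        (Complex.exp (-Complex.I * ((∑ i, θ i * (y i + (m i : ℝ)) : ℝ) : ℂ)) *
        (starRingEnd ℂ)
          (Complex.exp (-Complex.I * ((∑ i, θ i * (y i + (n i : ℝ)) : ℝ) : ℂ))))) dualCell := by
    intro m n
    refine (Continuous.integrableOn_Icc ?_).mono_set dualCell_subset_Icc
    fun_prop
  simp only [h1]
  rw [integral_finsetSum _ fun m _ => integrable_finsetSum _ fun n _ => hint m n]
  rw [Complex.ofReal_sum]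
  refine Finset.sum_congr rfl fun m hm => ?_
  rw [integral_finsetSum _ fun n _ => hint m n]
  simp only [integral_const_mul, integral_dualCell_exp_mul_conj, mul_ite, mul_zero]
  rw [Finset.sum_ite_eq, if_pos hm, Complex.ofReal_pow, ← Complex.mul_conj']
  have : (2 * (Real.pi : ℂ)) ^ 3 ≠ 0 := by
    simp [Real.pi_ne_zero]
  field_simp

lemma integral_eq_tsum_integral_cell {f : (Fin 3 → ℝ) → ℝ} (hf : Integrable f) :
    ∫ x, f x = ∑' m : Fin 3 → ℤ, ∫ y in cell, f (y + fun i => (m i : ℝ)) := by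
  let T : (Fin 3 → ℤ) → Set (Fin 3 → ℝ) := fun m => (· + fun i => -(m i : ℝ)) ⁻¹' cell
  have hT : ∀ m x, x ∈ T m ↔ ∀ i, ⌊x i + 1 / 2⌋ = m i := fun m x => by
    simp only [T, cell, Set.mem_preimage, Set.mem_univ_pi, Set.mem_Ico, Pi.add_apply,
      Int.floor_eq_iff]
    refine forall_congr' fun i => ⟨fun h => ⟨?_, ?_⟩, fun h => ⟨?_, ?_⟩⟩ <;> linarith [h.1, h.2]
  have hU : ⋃ m, T m = Set.univ := by
    refine Set.eq_univ_of_forall fun x => Set.mem_iUnion.2 ⟨fun i => ⌊x i + 1 / 2⌋, ?_⟩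
    exact (hT _ _).2 fun _ => rfl
  have hm : ∀ m, MeasurableSet (T m) := fun m =>
    measurableSet_cell.preimage (measurable_add_const _)
  have hd : Pairwise (Function.onFun Disjoint T) := fun m n hmn =>
    Set.disjoint_left.2 fun x h1 h2 => hmn <| funext fun i =>
      ((hT _ _).1 h1 i).symm.trans ((hT _ _).1 h2 i)
  rw [← setIntegral_univ, ← hU, integral_iUnion hm hd hf.integrableOn]
  refine tsum_congr fun m => ?_
  rw [← (measurePreserving_add_right volume (fun i => -(m i : ℝ))).setIntegral_preimage_emb
    (measurableEmbedding_addRight _) _ cell]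
  refine setIntegral_congr_fun (hm m) fun x _ => ?_
  congr 1
  ext i
  simp
lemma measurableSet_fiberSet (r : ℝ) : MeasurableSet (fiberSet r) := by
  have : fiberSet r = ⋃ m : Fin 2 → ℤ,
      {y | (y 0 - (m 0 : ℝ)) ^ 2 + (y 1 - (m 1 : ℝ)) ^ 2 < r ^ 2} := by
    ext y
    simp [fiberSet]
  rw [this]
  refine MeasurableSet.iUnion fun m => measurableSet_lt ?_ measurable_const
  fun_prop

lemma add_intCast_mem_fiberSet_iff (r : ℝ) (y : Fin 3 → ℝ) (m : Fin 3 → ℤ) :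
    (y + fun i => (m i : ℝ)) ∈ fiberSet r ↔ y ∈ fiberSet r := by
  constructor
  · rintro ⟨n, hn⟩
    refine ⟨![n 0 - m 0, n 1 - m 1], ?_⟩
    convert hn using 3 <;> simp <;> ring
  · rintro ⟨n, hn⟩
    refine ⟨![n 0 + m 0, n 1 + m 1], ?_⟩
    convert hn using 3 <;> simp

/-- Bounded measurable real functions on `ℝ³` that are periodic with respect to `ℤ³`. -/
structure IsBoundedPeriodicWeight (W : (Fin 3 → ℝ) → ℝ) : Prop where
  measurable : Measurable W
  bounded : ∃ C : ℝ, ∀ y, |W y| ≤ C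
  periodic : ∀ y (m : Fin 3 → ℤ), W (y + fun i => (m i : ℝ)) = W y

lemma IsBoundedPeriodicWeight.const (c : ℝ) : IsBoundedPeriodicWeight fun _ => c :=
  ⟨measurable_const, ⟨|c|, fun _ => le_rfl⟩, fun _ _ => rfl⟩

lemma IsBoundedPeriodicWeight.comp_apply {a : ℝ → ℝ} (ha : Measurable a)
    (hper : Function.Periodic a 1) {C : ℝ} (hC : ∀ s, |a s| ≤ C) (i : Fin 3) :
    IsBoundedPeriodicWeight fun y => a (y i) :=
  ⟨ha.comp (measurable_pi_apply i), ⟨C, fun y => hC (y i)⟩,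
    fun y m => by simpa using hper.int_mul (m i) (y i)⟩

lemma IsBoundedPeriodicWeight.ite_fiberSet {W₁ W₂ : (Fin 3 → ℝ) → ℝ}
    (h₁ : IsBoundedPeriodicWeight W₁) (h₂ : IsBoundedPeriodicWeight W₂) (r : ℝ) :
    IsBoundedPeriodicWeight fun y => if y ∈ fiberSet r then W₁ y else W₂ y := by
  obtain ⟨C₁, hC₁⟩ := h₁.bounded
  obtain ⟨C₂, hC₂⟩ := h₂.bounded
  refine ⟨Measurable.ite (measurableSet_fiberSet r) h₁.measurable h₂.measurable,
    ⟨max C₁ C₂, fun y => ?_⟩, fun y m => ?_⟩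
  · split_ifs
    · exact (hC₁ y).trans (le_max_left _ _)
    · exact (hC₂ y).trans (le_max_right _ _)
  · simp only [add_intCast_mem_fiberSet_iff, h₁.periodic, h₂.periodic]

lemma integrableOn_mul_norm_sq_gelfand {f : (Fin 3 → ℝ) → ℂ} (hf : Continuous f)
    (hs : HasCompactSupport f) {W : (Fin 3 → ℝ) → ℝ} (hW : IsBoundedPeriodicWeight W) :
    Integrable (fun p : (Fin 3 → ℝ) × (Fin 3 → ℝ) => W p.2 * ‖gelfand f p.1 p.2‖ ^ 2)
      ((volume.restrict dualCell).prod (volume.restrict cell)) ∧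
    ∀ θ, IntegrableOn (fun y => W y * ‖gelfand f θ y‖ ^ 2) cell := by
  obtain ⟨C, hC⟩ := hW.bounded
  obtain ⟨S, hS⟩ := exists_finset_forall_add_intCast_eq_zero hs (1 / 2)
  have hg : ∀ y ∈ cell, ∀ θ, gelfand f θ y = gelfandFinset S f θ y := fun y hy θ =>
    gelfand_eq_gelfandFinset (hS y (norm_le_of_mem_cell hy)) θ
  have hc := continuous_gelfandFinset S hf
  constructor
  · rw [Measure.prod_restrict]
    refine IntegrableOn.congr_fun (f := fun p : (Fin 3 → ℝ) × (Fin 3 → ℝ) =>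
      W p.2 * ‖gelfandFinset S f p.1 p.2‖ ^ 2) ?_ (fun p hp => by simp only [hg p.2 hp.2])
      (measurableSet_dualCell.prod measurableSet_cell)
    refine Integrable.bdd_mul (c := C) ?_ (hW.measurable.comp measurable_snd).aestronglyMeasurable
      (Filter.Eventually.of_forall fun p => hC p.2)
    exact IntegrableOn.mono_set ((hc.norm.pow 2).continuousOn.integrableOn_compact
      (isCompact_Icc.prod isCompact_Icc)) (Set.prod_mono dualCell_subset_Icc cell_subset_Icc)
  · intro θ
    refine IntegrableOn.congr_fun (f := fun y =>
      W y * ‖gelfandFinset S f θ y‖ ^ 2) ?_ (fun y hy => by simp only [hg y hy])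
      measurableSet_cell
    refine Integrable.bdd_mul (c := C) ?_ hW.measurable.aestronglyMeasurable
      (Filter.Eventually.of_forall hC)
    have hc' := hc.comp (Continuous.prodMk_right (X := Fin 3 → ℝ) (Y := Fin 3 → ℝ) θ)
    rw [Function.comp_def] at hc'
    have hc'' : Continuous fun y => ‖gelfandFinset S f θ y‖ ^ 2 := hc'.norm.pow 2
    exact hc''.integrableOn_Icc.mono_set cell_subset_Icc

lemma integrable_mul_norm_sq {f : (Fin 3 → ℝ) → ℂ} (hf : Continuous f)
    (hs : HasCompactSupport f) {W : (Fin 3 → ℝ) → ℝ} (hW : IsBoundedPeriodicWeight W) :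
    Integrable fun y => W y * ‖f y‖ ^ 2 := by
  obtain ⟨C, hC⟩ := hW.bounded
  refine Integrable.bdd_mul (c := C) ?_ hW.measurable.aestronglyMeasurable
      (Filter.Eventually.of_forall hC)
  have hs' : HasCompactSupport fun y => ‖f y‖ ^ 2 :=
    hs.comp_left (g := fun z : ℂ => ‖z‖ ^ 2) (by simp)
  have hf' : Continuous fun y => ‖f y‖ ^ 2 := hf.norm.pow 2
  exact hf'.integrable_of_hasCompactSupport hs'

lemma integral_integral_mul_norm_sq_gelfand {f : (Fin 3 → ℝ) → ℂ} (hf : Continuous f)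
    (hs : HasCompactSupport f) {W : (Fin 3 → ℝ) → ℝ} (hW : IsBoundedPeriodicWeight W) :
    ∫ θ in dualCell, ∫ y in cell, W y * ‖gelfand f θ y‖ ^ 2 = ∫ y, W y * ‖f y‖ ^ 2 := by
  obtain ⟨S, hS⟩ := exists_finset_forall_add_intCast_eq_zero hs (1 / 2)
  have hint := integrable_mul_norm_sq hf hs hW
  have hpt : ∀ y ∈ cell, ∫ θ in dualCell, W y * ‖gelfand f θ y‖ ^ 2 =
      ∑ m ∈ S, W (y + fun i => (m i : ℝ)) * ‖f (y + fun i => (m i : ℝ))‖ ^ 2 := fun y hy => by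
    simp only [gelfand_eq_gelfandFinset (hS y (norm_le_of_mem_cell hy)), hW.periodic]
    rw [integral_const_mul, integral_dualCell_norm_sq_gelfandFinset, Finset.mul_sum]
  rw [integral_integral_swap (integrableOn_mul_norm_sq_gelfand hf hs hW).1,
    setIntegral_congr_fun measurableSet_cell hpt,
    integral_finsetSum _ fun m _ => (hint.comp_add_right _).integrableOn,
    integral_eq_tsum_integral_cell hint, tsum_eq_sum (s := S)]
  intro m hm
  refine setIntegral_eq_zero_of_forall_eq_zero fun y hy => ?_
  simp [hS y (norm_le_of_mem_cell hy) m hm]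

lemma continuous_pd3 {f : (Fin 3 → ℝ) → ℂ} (hf : ContDiff ℝ 1 f) (j : Fin 3) :
    Continuous (pd3 f j) :=
  (hf.continuous_fderiv one_ne_zero).clm_apply continuous_const

lemma hasCompactSupport_pd3 {f : (Fin 3 → ℝ) → ℂ} (hs : HasCompactSupport f) (j : Fin 3) :
    HasCompactSupport (pd3 f j) :=
  (hs.fderiv ℝ).comp_left (g := fun L : (Fin 3 → ℝ) →L[ℝ] ℂ => L (Pi.single j 1)) rfl

lemma pd3_gelfand_add {f : (Fin 3 → ℝ) → ℂ} (hf : ContDiff ℝ 1 f)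
    (hs : HasCompactSupport f) (θ y : Fin 3 → ℝ) (j : Fin 3) :
    pd3 (gelfand f θ) j y + Complex.I * (θ j : ℂ) * gelfand f θ y =
      gelfand (pd3 f j) θ y := by
  obtain ⟨S₁, hS₁⟩ := exists_finset_forall_add_intCast_eq_zero hs (‖y‖ + 1)
  obtain ⟨S₂, hS₂⟩ :=
    exists_finset_forall_add_intCast_eq_zero (hasCompactSupport_pd3 hs j) (‖y‖ + 1)
  have hy : ‖y‖ ≤ ‖y‖ + 1 := by linarith
  have heq : ∀ z, ‖z‖ ≤ ‖y‖ + 1 → gelfand f θ z = gelfandFinset (S₁ ∪ S₂) f θ z :=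
    fun z hz => gelfand_eq_gelfandFinset
      (fun m hm => hS₁ z hz m fun h => hm (Finset.mem_union_left _ h)) θ
  have hev : gelfand f θ =ᶠ[nhds y] gelfandFinset (S₁ ∪ S₂) f θ := by
    filter_upwards [continuous_norm.continuousAt.eventually_lt_const (lt_add_one ‖y‖)] with z hz
    exact heq z hz.le
  rw [gelfand_eq_gelfandFinset (S := S₁ ∪ S₂)
    (fun m hm => hS₂ y hy m fun h => hm (Finset.mem_union_right _ h)) θ,
    ← pd3_gelfandFinset_add _ (hf.differentiable one_ne_zero), heq y hy]
  unfold pd3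
  rw [hev.fderiv_eq]

lemma integrable_add_add_and_integral_eq {α : Type*} [MeasurableSpace α] {μ : Measure α}
    {f g h : α → ℝ} (hf : Integrable f μ) (hg : Integrable g μ) (hh : Integrable h μ) :
    Integrable (fun x => f x + g x + h x) μ ∧
      ∫ x, (f x + g x + h x) ∂μ = (∫ x, f x ∂μ) + (∫ x, g x ∂μ) + ∫ x, h x ∂μ := by
  have hfg : Integrable (fun x => f x + g x) μ := hf.add hg
  exact ⟨hfg.add hh, by rw [integral_add hfg hh, integral_add hf hg]⟩

lemma aForm_gelfand {r : ℝ} {a : ℝ → ℝ}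
    (ha : IsBoundedPeriodicWeight fun y => a (y 2))
    {f : (Fin 3 → ℝ) → ℂ} (hf : ContDiff ℝ 1 f) (hs : HasCompactSupport f)
    (θ : Fin 3 → ℝ) :
    aForm a r θ (gelfand f θ) =
      (∫ y in cell, (if y ∈ fiberSet r then 0 else 1) * ‖gelfand (pd3 f 0) θ y‖ ^ 2) +
      (∫ y in cell, (if y ∈ fiberSet r then 0 else 1) * ‖gelfand (pd3 f 1) θ y‖ ^ 2) +
      ∫ y in cell, (if y ∈ fiberSet r then a (y 2) else 1) * ‖gelfand (pd3 f 2) θ y‖ ^ 2 := by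
  have hi : ∀ j, IntegrableOn (fun y => (if y ∈ fiberSet r then (0 : ℝ) else 1) *
      ‖gelfand (pd3 f j) θ y‖ ^ 2) cell := fun j =>
    (integrableOn_mul_norm_sq_gelfand (continuous_pd3 hf j) (hasCompactSupport_pd3 hs j)
      (.ite_fiberSet (.const 0) (.const 1) r)).2 θ
  have hi2 : IntegrableOn (fun y => (if y ∈ fiberSet r then a (y 2) else 1) *
      ‖gelfand (pd3 f 2) θ y‖ ^ 2) cell :=
    (integrableOn_mul_norm_sq_gelfand (continuous_pd3 hf 2) (hasCompactSupport_pd3 hs 2)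
      (.ite_fiberSet ha (.const 1) r)).2 θ
  rw [← (integrable_add_add_and_integral_eq (hi 0) (hi 1) hi2).2, aForm]
  refine integral_congr_ae (Filter.Eventually.of_forall fun y => ?_)
  simp only [pd3_gelfand_add hf hs, Fin.sum_univ_three]
  split_ifs <;> simp

lemma bForm_gelfand (r : ℝ) {f : (Fin 3 → ℝ) → ℂ} (hf : ContDiff ℝ 1 f)
    (hs : HasCompactSupport f) (θ : Fin 3 → ℝ) :
    bForm r θ (gelfand f θ) =
      (∫ y in cell, (if y ∈ fiberSet r then 1 else 0) * ‖gelfand (pd3 f 0) θ y‖ ^ 2) +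
      (∫ y in cell, (if y ∈ fiberSet r then 1 else 0) * ‖gelfand (pd3 f 1) θ y‖ ^ 2) +
      ∫ y in cell, 1 * ‖gelfand f θ y‖ ^ 2 := by
  have hi : ∀ j, IntegrableOn (fun y => (if y ∈ fiberSet r then (1 : ℝ) else 0) *
      ‖gelfand (pd3 f j) θ y‖ ^ 2) cell := fun j =>
    (integrableOn_mul_norm_sq_gelfand (continuous_pd3 hf j) (hasCompactSupport_pd3 hs j)
      (.ite_fiberSet (.const 1) (.const 0) r)).2 θ
  simp only [one_mul]
  rw [← integral_add (hi 0) (hi 1), bForm]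
  congr 1
  refine integral_congr_ae (Filter.Eventually.of_forall fun y => ?_)
  simp only [pd3_gelfand_add hf hs]
  split_ifs <;> simp

/-- The energy form of `f` equals the integral of its fibre forms over the dual cell. -/
lemma integral_dualCell_forms_gelfand {r : ℝ} {a : ℝ → ℝ} (c : ℝ)
    (ha : IsBoundedPeriodicWeight fun y => a (y 2))
    {f : (Fin 3 → ℝ) → ℂ} (hf : ContDiff ℝ 1 f) (hs : HasCompactSupport f) :
    ∫ θ in dualCell, (c * aForm a r θ (gelfand f θ) + bForm r θ (gelfand f θ)) =
      ∫ y, ((if y ∈ fiberSet r then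
        ‖pd3 f 0 y‖ ^ 2 + ‖pd3 f 1 y‖ ^ 2 + c * (a (y 2) * ‖pd3 f 2 y‖ ^ 2)
        else c * ∑ j, ‖pd3 f j y‖ ^ 2) + ‖f y‖ ^ 2) := by
  have h01 : IsBoundedPeriodicWeight fun y => if y ∈ fiberSet r then (0 : ℝ) else 1 :=
    .ite_fiberSet (.const 0) (.const 1) r
  have h10 : IsBoundedPeriodicWeight fun y => if y ∈ fiberSet r then (1 : ℝ) else 0 :=
    .ite_fiberSet (.const 1) (.const 0) r
  have ha1 : IsBoundedPeriodicWeight fun y => if y ∈ fiberSet r then a (y 2) else 1 :=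
    .ite_fiberSet ha (.const 1) r
  have h1 := IsBoundedPeriodicWeight.const 1
  have hc := continuous_pd3 hf
  have hk := hasCompactSupport_pd3 hs
  have hθ : ∀ {h : (Fin 3 → ℝ) → ℂ} {W : (Fin 3 → ℝ) → ℝ}, Continuous h →
      HasCompactSupport h → IsBoundedPeriodicWeight W →
      IntegrableOn (fun θ => ∫ y in cell, W y * ‖gelfand h θ y‖ ^ 2) dualCell :=
    fun hh hh' hW => (integrableOn_mul_norm_sq_gelfand hh hh' hW).1.integral_prod_left
  simp only [aForm_gelfand ha hf hs, bForm_gelfand r hf hs]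
  have i0 := hθ (hc 0) (hk 0) h01
  have i1 := hθ (hc 1) (hk 1) h01
  have i2 := hθ (hc 2) (hk 2) ha1
  have j0 := hθ (hc 0) (hk 0) h10
  have j1 := hθ (hc 1) (hk 1) h10
  have j2 := hθ hf.continuous hs h1
  obtain ⟨i3, i4⟩ := integrable_add_add_and_integral_eq i0 i1 i2
  obtain ⟨j3, j4⟩ := integrable_add_add_and_integral_eq j0 j1 j2
  rw [integral_add (i3.const_mul c) j3, integral_const_mul, i4, j4]
  rw [integral_integral_mul_norm_sq_gelfand (hc 0) (hk 0) h01,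
    integral_integral_mul_norm_sq_gelfand (hc 1) (hk 1) h01,
    integral_integral_mul_norm_sq_gelfand (hc 2) (hk 2) ha1,
    integral_integral_mul_norm_sq_gelfand (hc 0) (hk 0) h10,
    integral_integral_mul_norm_sq_gelfand (hc 1) (hk 1) h10,
    integral_integral_mul_norm_sq_gelfand hf.continuous hs h1]
  have k0 := integrable_mul_norm_sq (hc 0) (hk 0) h01
  have k1 := integrable_mul_norm_sq (hc 1) (hk 1) h01
  have k2 := integrable_mul_norm_sq (hc 2) (hk 2) ha1
  have l0 := integrable_mul_norm_sq (hc 0) (hk 0) h10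
  have l1 := integrable_mul_norm_sq (hc 1) (hk 1) h10
  have l2 := integrable_mul_norm_sq hf.continuous hs h1
  obtain ⟨k3, k4⟩ := integrable_add_add_and_integral_eq k0 k1 k2
  obtain ⟨l3, l4⟩ := integrable_add_add_and_integral_eq l0 l1 l2
  rw [← k4, ← l4, ← integral_const_mul, ← integral_add (k3.const_mul c) l3]
  refine integral_congr_ae (Filter.Eventually.of_forall fun y => ?_)
  simp only [Fin.sum_univ_three]
  split_ifs
  · simp
    ring
  · simp

lemma norm_sq_pd3_const_mul_comp_smul {u : (Fin 3 → ℝ) → ℂ} (hu : Differentiable ℝ u)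
    (c : ℂ) (ε : ℝ) (j : Fin 3) (y : Fin 3 → ℝ) :
    ‖pd3 (fun x => c * u (ε • x)) j y‖ ^ 2 = ‖c‖ ^ 2 * ε ^ 2 * ‖pd3 u j (ε • y)‖ ^ 2 := by
  have h : HasFDerivAt (fun x => c * u (ε • x)) _ y :=
    (((hu (ε • y)).hasFDerivAt).comp y ((hasFDerivAt_id y).const_smul ε)).const_mul c
  unfold pd3
  rw [h.fderiv]
  simp [mul_pow]
  ring

/-- Floquet decomposition of the energy form: for `u ∈ C¹_c(ℝ³)`,
`∫_{ℝ³} (A_ε(x/ε)∇u·∇u̅ + |u|²) dx = ∫_{□*} (ε⁻² a_θ[u_{ε,θ}] + b_θ[u_{ε,θ}]) dθ`, where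
`u_{ε,θ} = U Γ_ε u (θ,·)` with `Γ_ε u(x) = ε^{3/2} u(εx)`, and
`A_ε(y) = χ₁(y) I + χ₀(y) diag(ε², ε², a(y₃))`. -/
theorem floquet_energy_decomposition
    (r ν ε : ℝ) (hr : 0 < r) (hr' : r < 1 / 2) (hν : 0 < ν)
    (a : ℝ → ℝ) (ha_meas : Measurable a) (ha_per : ∀ s, a (s + 1) = a s)
    (ha_lb : ∀ s, ν < a s) (ha_ub : ∀ s, a s < ν⁻¹)
    (hε : 0 < ε) (hε' : ε < 1)
    (u : (Fin 3 → ℝ) → ℂ) (hu : ContDiff ℝ 1 u) (hsupp : HasCompactSupport u) :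
    (∫ x, ((if ε⁻¹ • x ∈ fiberSet r then
              ε ^ 2 * (‖pd3 u 0 x‖ ^ 2 + ‖pd3 u 1 x‖ ^ 2) + a (x 2 / ε) * ‖pd3 u 2 x‖ ^ 2
            else ∑ j, ‖pd3 u j x‖ ^ 2) + ‖u x‖ ^ 2)) =
    ∫ θ in dualCell,
      ((ε ^ 2)⁻¹ *
          aForm a r θ (gelfand (fun x => ((ε ^ ((3 : ℝ) / 2) : ℝ) : ℂ) * u (ε • x)) θ) +
        bForm r θ (gelfand (fun x => ((ε ^ ((3 : ℝ) / 2) : ℝ) : ℂ) * u (ε • x)) θ)) := by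
  have ha : IsBoundedPeriodicWeight fun y => a (y 2) :=
    .comp_apply ha_meas ha_per (C := ν⁻¹)
      (fun s => (abs_of_pos (hν.trans (ha_lb s))).trans_le (ha_ub s).le) 2
  have hnorm : ‖((ε ^ ((3 : ℝ) / 2) : ℝ) : ℂ)‖ ^ 2 = ε ^ 3 := by
    rw [Complex.norm_real, Real.norm_eq_abs, sq_abs, ← Real.rpow_natCast, ← Real.rpow_mul hε.le,
      ← Real.rpow_natCast]
    norm_num
  have hf : ContDiff ℝ 1 fun x => ((ε ^ ((3 : ℝ) / 2) : ℝ) : ℂ) * u (ε • x) :=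
    contDiff_const.mul (hu.comp (contDiff_const_smul ε))
  have hs : HasCompactSupport fun x => ((ε ^ ((3 : ℝ) / 2) : ℝ) : ℂ) * u (ε • x) :=
    (hsupp.comp_smul hε.ne').mul_left
  rw [integral_dualCell_forms_gelfand _ ha hf hs]
  simp only [norm_sq_pd3_const_mul_comp_smul (hu.differentiable one_ne_zero), norm_mul, mul_pow,
    hnorm]
  set F : (Fin 3 → ℝ) → ℝ := fun x => (if ε⁻¹ • x ∈ fiberSet r then
      ε ^ 2 * (‖pd3 u 0 x‖ ^ 2 + ‖pd3 u 1 x‖ ^ 2) + a (x 2 / ε) * ‖pd3 u 2 x‖ ^ 2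
    else ∑ j, ‖pd3 u j x‖ ^ 2) + ‖u x‖ ^ 2 with hF
  have hscale := Measure.integral_comp_smul volume F ε
  rw [Module.finrank_fin_fun, abs_of_pos (by positivity), smul_eq_mul,
    eq_inv_mul_iff_mul_eq₀ (by positivity), ← integral_const_mul] at hscale
  rw [← hscale]
  refine integral_congr_ae (Filter.Eventually.of_forall fun y => ?_)
  have hy : (ε • y) 2 / ε = y 2 := by
    simp [hε.ne']
  simp only [hF, inv_smul_smul₀ hε.ne', hy, Fin.sum_univ_three]
  split_ifs <;> field_simp
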